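/- arXiv:1608.03723 — 2 statements merged into one kernel-verified Lean document; each statement's English description precedes it below -/
import Mathlib

section
/- For every ω > 0, t > 0, λ ∈ ℝ, and n ∈ ℕ with n > ωt/π, one has |e^{iλt} − Σ_{k=−n}^{n} e^{iλkπ/ω}·sinc(ωt − kπ)| ≤ 2 + (2|sin(ωt)|/π)·(1 + Si(π) + (ωt/π + 0.5)/(n − ωt/π)). -/
open MeasureTheory

noncomputable section

/-- `sinc` function: `sin u / u` for `u ≠ 0` and `1` at `0`. -/
def msinc (u : ℝ) : ℝ := if u = 0 then 1 else Real.sin u / u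

/-- `Si(π) = ∫₀^π sin x / x dx`. -/
def SiPi : ℝ := ∫ x in (0:ℝ)..Real.pi, Real.sin x / x

theorem msinc_eq_real_sinc (u : ℝ) : msinc u = Real.sinc u := by
  rw [msinc, Real.sinc_apply]

theorem siPi_eq_integral_sinc : SiPi = ∫ x in (0:ℝ)..Real.pi, Real.sinc x := by
  unfold SiPi
  apply intervalIntegral.integral_congr_ae
  filter_upwards with x hx
  rw [Set.uIoc_of_le Real.pi_pos.le] at hx
  rw [Real.sinc_of_ne_zero hx.1.ne']

theorem mul_sin_le_mul_sin {s b : ℝ} (hs : 0 ≤ s) (hsb : s ≤ b) (hb : b ≤ Real.pi) :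
    s * Real.sin b ≤ b * Real.sin s := by
  rcases hs.eq_or_lt with rfl | hs
  · simp
  have hb0 : 0 < b := hs.trans_le hsb
  have hle : 0 ≤ 1 - s / b := by rw [sub_nonneg, div_le_one hb0]; exact hsb
  have hdiv : 0 ≤ s / b := by positivity
  have h := strictConcaveOn_sin_Icc.concaveOn.2 (Set.left_mem_Icc.2 Real.pi_pos.le)
    (⟨hb0.le, hb⟩ : b ∈ Set.Icc 0 Real.pi) hle hdiv (sub_add_cancel _ _)
  simp only [smul_eq_mul, Real.sin_zero, mul_zero, zero_add] at h
  rw [div_mul_cancel₀ _ hb0.ne'] at h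
  calc s * Real.sin b = b * (s / b * Real.sin b) := by field_simp
    _ ≤ b * Real.sin s := by gcongr

theorem sinc_le_sinc {s b : ℝ} (hs : 0 ≤ s) (hsb : s ≤ b) (hb : b ≤ Real.pi) :
    Real.sinc b ≤ Real.sinc s := by
  rcases hs.eq_or_lt with rfl | hs
  · simpa using Real.sinc_le_one b
  have hb0 : 0 < b := hs.trans_le hsb
  rw [Real.sinc_of_ne_zero hs.ne', Real.sinc_of_ne_zero hb0.ne', div_le_div_iff₀ hb0 hs]
  linarith [mul_sin_le_mul_sin hs.le hsb hb]

theorem sum_sin_div_le_integral_sinc {φ : ℝ} (hφ : 0 < φ) (N : ℕ) (hN : N * φ ≤ Real.pi) :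
    ∑ j ∈ Finset.range N, Real.sin ((j + 1) * φ) / (j + 1) ≤
      ∫ x in (0:ℝ)..(N * φ), Real.sinc x := by
  induction N with
  | zero => simp
  | succ N ih =>
    push_cast at hN ⊢
    have hNφ : (N : ℝ) * φ ≤ (N + 1) * φ := by nlinarith
    have h0 : (0 : ℝ) ≤ N * φ := by positivity
    have hpos : (0 : ℝ) < (N + 1) * φ := by positivity
    rw [Finset.sum_range_succ, ← intervalIntegral.integral_add_adjacent_intervals
      (Real.continuous_sinc.intervalIntegrable 0 (N * φ))
      (Real.continuous_sinc.intervalIntegrable (N * φ) ((N + 1) * φ))]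
    refine add_le_add (ih (hNφ.trans hN)) ?_
    calc Real.sin ((N + 1) * φ) / (N + 1)
        = ∫ _ in (N * φ)..((N + 1) * φ), Real.sinc ((N + 1) * φ) := by
          rw [intervalIntegral.integral_const, Real.sinc_of_ne_zero hpos.ne', smul_eq_mul]
          field_simp
          ring
      _ ≤ _ := intervalIntegral.integral_mono_on hNφ (by simp)
          (Real.continuous_sinc.intervalIntegrable _ _)
          fun s hs => sinc_le_sinc (h0.trans hs.1) hs.2 hN

theorem sum_sin_div_le_siPi {φ : ℝ} (hφ : 0 < φ) (N : ℕ) (hN : N * φ ≤ Real.pi) :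
    ∑ j ∈ Finset.range N, Real.sin ((j + 1) * φ) / (j + 1) ≤ SiPi := by
  refine (sum_sin_div_le_integral_sinc hφ N hN).trans ?_
  rw [siPi_eq_integral_sinc]
  refine intervalIntegral.integral_mono_interval le_rfl (by positivity) hN ?_
    (Real.continuous_sinc.intervalIntegrable _ _)
  filter_upwards [ae_restrict_mem measurableSet_Ioc] with x hx
  rw [Real.sinc_of_ne_zero hx.1.ne']
  exact div_nonneg (Real.sin_nonneg_of_nonneg_of_le_pi hx.1.le hx.2) hx.1.le

theorem sum_sin_div_nonneg {φ : ℝ} (hφ : 0 < φ) (N : ℕ) (hN : N * φ ≤ Real.pi) :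
    0 ≤ ∑ j ∈ Finset.range N, Real.sin ((j + 1) * φ) / (j + 1) := by
  refine Finset.sum_nonneg fun j hj => ?_
  have hj' : (j : ℝ) + 1 ≤ N := by exact_mod_cast Finset.mem_range.1 hj
  have : ((j : ℝ) + 1) * φ ≤ N * φ := by gcongr
  exact div_nonneg (Real.sin_nonneg_of_nonneg_of_le_pi (by positivity) (this.trans hN))
    (by positivity)

theorem one_le_siPi : 1 ≤ SiPi := by
  have := sum_sin_div_le_siPi (φ := Real.pi / 2) (by positivity) 1
    (by push_cast; linarith [Real.pi_pos])
  simpa using this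

theorem sum_sub_div_le {c : ℕ → ℝ} {C : ℝ} (hc : ∀ j, C ≤ c j) (N m : ℕ) :
    ∑ j ∈ Finset.Ico N (N + m), (c j - c (j + 1)) / (j + 1) ≤
      (c N - C) / (N + 1) - (c (N + m) - C) / ((N + m : ℕ) + 1) := by
  induction m with
  | zero => simp
  | succ m ih =>
    rw [← add_assoc, Finset.sum_Ico_succ_top (by omega)]
    have h : (c (N + m + 1) - C) / (((N + m + 1 : ℕ) : ℝ) + 1) ≤
        (c (N + m + 1) - C) / (((N + m : ℕ) : ℝ) + 1) := by
      refine div_le_div_of_nonneg_left (sub_nonneg.2 (hc _)) (by positivity) ?_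
      push_cast
      linarith
    have h' : (c (N + m) - c (N + m + 1)) / (((N + m : ℕ) : ℝ) + 1) =
        (c (N + m) - C) / (((N + m : ℕ) : ℝ) + 1) -
          (c (N + m + 1) - C) / (((N + m : ℕ) : ℝ) + 1) := by ring
    linarith

theorem two_sin_half_mul_sin (φ : ℝ) (j : ℕ) :
    2 * Real.sin (φ / 2) * Real.sin ((j + 1) * φ) =
      Real.cos ((j + 1 / 2) * φ) - Real.cos (((j + 1 : ℕ) + 1 / 2) * φ) := by
  rw [Real.cos_sub_cos, show ((j + 1 / 2) * φ + ((j + 1 : ℕ) + 1 / 2) * φ) / 2 = (j + 1) * φ by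
    push_cast; ring, show ((j + 1 / 2) * φ - ((j + 1 : ℕ) + 1 / 2) * φ) / 2 = -(φ / 2) by
    push_cast; ring, Real.sin_neg]
  ring

theorem abs_sum_sin_div_le_of_mem_Ioc {φ : ℝ} (hφ : 0 < φ) (hφ' : φ ≤ Real.pi) (M : ℕ) :
    |∑ j ∈ Finset.range M, Real.sin ((j + 1) * φ) / (j + 1)| ≤ SiPi + 1 / 4 := by
  by_cases hM : M * φ ≤ Real.pi
  · rw [abs_of_nonneg (sum_sin_div_nonneg hφ M hM)]
    linarith [sum_sin_div_le_siPi hφ M hM]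
  push Not at hM
  set N := ⌊Real.pi / φ⌋₊
  have hN : N * φ ≤ Real.pi := by
    rw [← le_div_iff₀ hφ]
    exact Nat.floor_le (by positivity)
  have hN1 : Real.pi < (N + 1) * φ := by
    rw [← div_lt_iff₀ hφ]
    exact Nat.lt_floor_add_one _
  have hN0 : (1 : ℝ) ≤ N := by
    have : 1 ≤ N := Nat.le_floor (by rw [Nat.cast_one, le_div_iff₀ hφ]; linarith)
    exact_mod_cast this
  have hNM : N ≤ M := by
    have : (N : ℝ) ≤ M := le_of_mul_le_mul_right (hN.trans hM.le) hφ
    exact_mod_cast this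
  obtain ⟨m, rfl⟩ := Nat.exists_eq_add_of_le hNM
  rw [← Finset.sum_range_add_sum_Ico _ hNM]
  set R := ∑ j ∈ Finset.Ico N (N + m), Real.sin ((j + 1) * φ) / (j + 1) with hR
  have hs0 : φ / Real.pi ≤ Real.sin (φ / 2) := by
    have := Real.mul_le_sin (x := φ / 2) (by positivity) (by linarith)
    calc φ / Real.pi = 2 / Real.pi * (φ / 2) := by ring
      _ ≤ _ := this
  have hspos : 0 < Real.sin (φ / 2) := lt_of_lt_of_le (by positivity) hs0
  have hc0 : 0 ≤ Real.cos (φ / 2) := Real.cos_nonneg_of_mem_Icc ⟨by linarith, by linarith⟩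
  have hsc : 1 ≤ Real.sin (φ / 2) + Real.cos (φ / 2) := by
    nlinarith [Real.sin_sq_add_cos_sq (φ / 2)]
  have hcN : Real.cos ((N + 1 / 2) * φ) ≤ - Real.cos (φ / 2) := by
    have h1 : Real.cos ((N + 1 / 2) * φ) = - Real.cos |(N + 1 / 2) * φ - Real.pi| := by
      rw [Real.cos_abs, Real.cos_sub_pi, neg_neg]
    rw [h1]
    refine neg_le_neg (Real.cos_le_cos_of_nonneg_of_le_pi (abs_nonneg _) (by linarith) ?_)
    rw [abs_le]
    constructor <;> linarith
  have hup := sum_sub_div_le (c := fun j : ℕ => Real.cos ((j + 1 / 2) * φ)) (C := -1)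
    (fun j => Real.neg_one_le_cos _) N m
  have hlo := sum_sub_div_le (c := fun j : ℕ => -Real.cos ((j + 1 / 2) * φ)) (C := -1)
    (fun j => by linarith [Real.cos_le_one ((j + 1 / 2) * φ)]) N m
  have hR1 : 2 * Real.sin (φ / 2) * R = ∑ j ∈ Finset.Ico N (N + m),
      (Real.cos ((j + 1 / 2) * φ) - Real.cos (((j + 1 : ℕ) + 1 / 2) * φ)) / (j + 1) := by
    rw [hR, Finset.mul_sum]
    refine Finset.sum_congr rfl fun j _ => ?_
    rw [← two_sin_half_mul_sin, mul_div_assoc]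
  have hR2 : -(2 * Real.sin (φ / 2) * R) = ∑ j ∈ Finset.Ico N (N + m),
      (-Real.cos ((j + 1 / 2) * φ) - -Real.cos (((j + 1 : ℕ) + 1 / 2) * φ)) / (j + 1) := by
    rw [hR1, ← Finset.sum_neg_distrib]
    exact Finset.sum_congr rfl fun j _ => by ring
  simp only [← hR1, ← hR2] at hup hlo
  have hup' : 0 ≤ (Real.cos (((N + m : ℕ) + 1 / 2) * φ) - -1) / (((N + m : ℕ) : ℝ) + 1) :=
    div_nonneg (by linarith [Real.neg_one_le_cos (((N + m : ℕ) + 1 / 2) * φ)]) (by positivity)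
  have hlo' : 0 ≤ (-Real.cos (((N + m : ℕ) + 1 / 2) * φ) - -1) / (((N + m : ℕ) : ℝ) + 1) :=
    div_nonneg (by linarith [Real.cos_le_one (((N + m : ℕ) + 1 / 2) * φ)]) (by positivity)
  have hupN : (Real.cos ((N + 1 / 2) * φ) - -1) / (N + 1) ≤ Real.sin (φ / 2) / 2 := by
    rw [div_le_div_iff₀ (by positivity) two_pos]
    nlinarith
  have hloN : (-Real.cos ((N + 1 / 2) * φ) - -1) / (N + 1) ≤ 2 * Real.sin (φ / 2) := by
    rw [div_le_iff₀ (by positivity)]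
    have h1 : 1 ≤ Real.sin (φ / 2) * (N + 1) := by
      calc (1 : ℝ) ≤ φ / Real.pi * (N + 1) := by
            rw [div_mul_eq_mul_div, le_div_iff₀ Real.pi_pos]; linarith
        _ ≤ _ := by gcongr
    nlinarith [Real.neg_one_le_cos ((N + 1 / 2) * φ)]
  have hRup : R ≤ 1 / 4 := by
    refine le_of_mul_le_mul_left (a := 2 * Real.sin (φ / 2)) ?_ (by positivity)
    linarith
  have hRlo : -1 ≤ R := by
    refine le_of_mul_le_mul_left (a := 2 * Real.sin (φ / 2)) ?_ (by positivity)
    linarith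
  have := sum_sin_div_le_siPi hφ N hN
  have := sum_sin_div_nonneg hφ N hN
  have := one_le_siPi
  rw [abs_le]
  constructor <;> linarith

theorem abs_sum_sin_div_le (φ : ℝ) (M : ℕ) :
    |∑ j ∈ Finset.range M, Real.sin ((j + 1) * φ) / (j + 1)| ≤ SiPi + 1 / 4 := by
  set m := round (φ / (2 * Real.pi))
  set ψ := φ - m * (2 * Real.pi) with hψ
  have hpi := Real.pi_pos
  have hψπ : |ψ| ≤ Real.pi := by
    have h : ψ = (φ / (2 * Real.pi) - m) * (2 * Real.pi) := by rw [hψ]; field_simp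
    rw [h, abs_mul, abs_of_pos (by positivity : 0 < 2 * Real.pi)]
    nlinarith [abs_sub_round (φ / (2 * Real.pi))]
  have hsum : ∀ j : ℕ, Real.sin ((j + 1) * φ) = Real.sin ((j + 1) * ψ) := fun j => by
    rw [hψ, show ((j : ℝ) + 1) * (φ - m * (2 * Real.pi)) =
      (j + 1) * φ - (((j + 1) * m : ℤ) : ℝ) * (2 * Real.pi) by push_cast; ring,
      Real.sin_sub_int_mul_two_pi]
  simp only [hsum]
  rcases lt_trichotomy ψ 0 with h | h | h
  · have := abs_sum_sin_div_le_of_mem_Ioc (φ := -ψ) (by linarith)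
      (by rwa [abs_of_neg h] at hψπ) M
    simpa only [mul_neg, Real.sin_neg, neg_div, Finset.sum_neg_distrib, abs_neg] using this
  · simp only [h, mul_zero, Real.sin_zero, zero_div, Finset.sum_const_zero, abs_zero]
    linarith [one_le_siPi]
  · exact abs_sum_sin_div_le_of_mem_Ioc h (by rwa [abs_of_pos h] at hψπ) M

theorem norm_div_sub_add_div_add_le {f J : ℝ} (hf : |f| ≤ 1 / 2) (hJ : 1 ≤ J) {w v : ℂ}
    (hw : ‖w‖ = 1) (hv : ‖v‖ = 1) :
    ‖w / (f - J : ℝ) + v / (f + J : ℝ) + (w - v) / J‖ ≤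
      2 * |f| * (1 / (J - 1 / 2) - 1 / (J + 1 / 2)) := by
  obtain ⟨hf1, hf2⟩ := abs_le.1 hf
  have hJ0 : 0 < J := by linarith
  have h1 : f - J < 0 := by linarith
  have h2 : 0 < f + J := by linarith
  have e : w / (f - J : ℝ) + v / (f + J : ℝ) + (w - v) / J =
      (f / J : ℝ) * (w / (f - J : ℝ) - v / (f + J : ℝ)) := by
    have c0 : (J : ℂ) ≠ 0 := by exact_mod_cast hJ0.ne'
    have c1 : (f : ℂ) - J ≠ 0 := by exact_mod_cast h1.ne
    have c2 : (f : ℂ) + J ≠ 0 := by exact_mod_cast h2.ne'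
    push_cast
    field_simp
    ring
  have hn : ‖w / (f - J : ℝ) - v / (f + J : ℝ)‖ ≤ 1 / (J - f) + 1 / (f + J) := by
    refine (norm_sub_le _ _).trans_eq ?_
    rw [norm_div, norm_div, hw, hv, Complex.norm_real, Complex.norm_real, Real.norm_eq_abs,
      Real.norm_eq_abs, abs_of_neg h1, abs_of_pos h2, neg_sub]
  rw [e, norm_mul, Complex.norm_real, Real.norm_eq_abs, abs_div, abs_of_pos hJ0]
  calc |f| / J * ‖w / (f - J : ℝ) - v / (f + J : ℝ)‖
      ≤ |f| / J * (1 / (J - f) + 1 / (f + J)) := by gcongr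
    _ = 2 * |f| * (1 / (J ^ 2 - f ^ 2)) := by
      have d1 : J - f ≠ 0 := by linarith
      have d3 : J ^ 2 - f ^ 2 ≠ 0 := by nlinarith
      field_simp
      ring
    _ ≤ 2 * |f| * (1 / (J ^ 2 - (1 / 2) ^ 2)) := by
      have : 0 < J ^ 2 - (1 / 2) ^ 2 := by nlinarith
      have : f ^ 2 ≤ (1 / 2) ^ 2 := sq_le_sq' (by linarith) hf2
      gcongr
    _ = _ := by
      have d1 : J - 1 / 2 ≠ 0 := by linarith
      have d2 : J + 1 / 2 ≠ 0 := by linarith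
      have d3 : J ^ 2 - (1 / 2) ^ 2 ≠ 0 := by nlinarith
      rw [div_sub_div _ _ d1 d2, show J ^ 2 - (1 / 2) ^ 2 = (J - 1 / 2) * (J + 1 / 2) by ring]
      ring

theorem norm_sum_exp_div_le {f : ℝ} (hf : |f| ≤ 1 / 2) (φ : ℝ) (M : ℕ) :
    ‖∑ j ∈ Finset.range M,
      (Complex.exp (((j + 1) * φ : ℝ) * Complex.I) / (f - (j + 1) : ℝ) +
        Complex.exp ((-((j + 1) * φ) : ℝ) * Complex.I) / (f + (j + 1) : ℝ))‖ ≤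
      2 * (2 * |f| + SiPi + 1 / 4) := by
  set w : ℕ → ℂ := fun j => Complex.exp (((j + 1) * φ : ℝ) * Complex.I) with hw
  set v : ℕ → ℂ := fun j => Complex.exp ((-((j + 1) * φ) : ℝ) * Complex.I) with hv
  have hsin : ∑ j ∈ Finset.range M, (w j - v j) / (j + 1 : ℝ) =
      2 * Complex.I * (∑ j ∈ Finset.range M, Real.sin ((j + 1) * φ) / (j + 1) : ℝ) := by
    rw [Complex.ofReal_sum, Finset.mul_sum]
    refine Finset.sum_congr rfl fun j _ => ?_
    simp only [hw, hv, Complex.exp_mul_I, ← Complex.ofReal_cos, ← Complex.ofReal_sin, Real.cos_neg,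
      Real.sin_neg]
    push_cast
    ring
  have htel : ∑ j ∈ Finset.range M,
      2 * |f| * (1 / ((j + 1 : ℝ) - 1 / 2) - 1 / ((j + 1 : ℝ) + 1 / 2)) ≤ 4 * |f| := by
    rw [← Finset.mul_sum]
    have := Finset.sum_range_sub' (fun j : ℕ => 1 / ((j : ℝ) + 1 / 2)) M
    rw [Finset.sum_congr rfl (g := fun j : ℕ => 1 / ((j : ℝ) + 1 / 2) -
      1 / (((j + 1 : ℕ) : ℝ) + 1 / 2)) fun j _ => by
        rw [show (j + 1 : ℝ) - 1 / 2 = j + 1 / 2 by ring]; push_cast; rfl, this]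
    have h0 : 0 ≤ 1 / ((M : ℝ) + 1 / 2) := by positivity
    have h1 : (1 : ℝ) / (((0 : ℕ) : ℝ) + 1 / 2) = 2 := by norm_num
    nlinarith [abs_nonneg f]
  have herr := norm_sum_le_of_le (Finset.range M) fun j _ =>
    norm_div_sub_add_div_add_le (J := j + 1) hf (by linarith [(Nat.cast_nonneg j : (0 : ℝ) ≤ j)])
      (Complex.norm_exp_ofReal_mul_I ((j + 1) * φ))
      (Complex.norm_exp_ofReal_mul_I (-((j + 1) * φ)))
  rw [Finset.sum_add_distrib] at herr
  have hsum := norm_sub_le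
    (∑ j ∈ Finset.range M, (w j / (f - (j + 1) : ℝ) + v j / (f + (j + 1) : ℝ)) +
      ∑ j ∈ Finset.range M, (w j - v j) / (j + 1 : ℝ))
    (∑ j ∈ Finset.range M, (w j - v j) / (j + 1 : ℝ))
  rw [add_sub_cancel_right] at hsum
  have hS : ‖∑ j ∈ Finset.range M, (w j - v j) / (j + 1 : ℝ)‖ ≤ 2 * (SiPi + 1 / 4) := by
    rw [hsin, norm_mul, norm_mul, Complex.norm_I, Complex.norm_real, Real.norm_eq_abs]
    have := abs_sum_sin_div_le φ M
    norm_num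
    linarith
  have := herr.trans htel
  linarith

theorem sum_Icc_sub_add_eq (G : ℤ → ℂ) (k : ℤ) (M : ℕ) :
    ∑ i ∈ Finset.Icc (k - M) (k + M), G i =
      G k + ∑ j ∈ Finset.range M, (G (k + (j + 1 : ℤ)) + G (k + (-(j + 1) : ℤ))) := by
  induction M with
  | zero => simp
  | succ M ih =>
    have h : Finset.Icc (k - ((M + 1 : ℕ) : ℤ)) (k + ((M + 1 : ℕ) : ℤ)) =
        insert (k + (M + 1 : ℤ)) (insert (k + (-(M + 1) : ℤ)) (Finset.Icc (k - M) (k + M))) := by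
      ext i
      simp only [Finset.mem_Icc, Finset.mem_insert]
      omega
    rw [h, Finset.sum_insert (by simp only [Finset.mem_Icc, Finset.mem_insert]; omega),
      Finset.sum_insert (by simp only [Finset.mem_Icc]; omega), ih,
      Finset.sum_range_succ]
    ring

theorem sinc_pi_mul_sub_int {x : ℝ} {j : ℤ} (h : x - j ≠ 0) :
    Real.sinc (Real.pi * (x - j)) = Real.sin (Real.pi * x) / Real.pi * ((-1) ^ j / (x - j)) := by
  rw [Real.sinc_of_ne_zero (mul_ne_zero Real.pi_ne_zero h),
    show Real.pi * (x - j) = Real.pi * x - j * Real.pi by ring, Real.sin_sub_int_mul_pi,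
    show Real.pi * x - j * Real.pi = Real.pi * (x - j) by ring]
  field_simp

theorem abs_sinc_pi_mul_sub_int {x : ℝ} {j : ℤ} (h : x - j ≠ 0) :
    |Real.sinc (Real.pi * (x - j))| = |Real.sin (Real.pi * x)| / Real.pi * (1 / |x - j|) := by
  rw [sinc_pi_mul_sub_int h, abs_mul, abs_div, abs_div, abs_of_pos Real.pi_pos, abs_zpow,
    abs_neg, abs_one, one_zpow]

theorem abs_sin_pi_mul_sub_int (x : ℝ) (k : ℤ) :
    |Real.sin (Real.pi * (x - k))| = |Real.sin (Real.pi * x)| := by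
  rw [show Real.pi * (x - k) = Real.pi * x - k * Real.pi by ring, Real.sin_sub_int_mul_pi,
    abs_mul, abs_zpow, abs_neg, abs_one, one_zpow, one_mul]

theorem exp_mul_sinc_eq (θ f : ℝ) {j : ℤ} (h : f - j ≠ 0) :
    Complex.exp ((θ * j : ℝ) * Complex.I) * (Real.sinc (Real.pi * (f - j)) : ℂ) =
      (Real.sin (Real.pi * f) / Real.pi : ℝ) *
        (Complex.exp ((j * (θ + Real.pi) : ℝ) * Complex.I) / (f - j : ℝ)) := by
  have e : Complex.exp ((j * (θ + Real.pi) : ℝ) * Complex.I) =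
      Complex.exp ((θ * j : ℝ) * Complex.I) * (-1) ^ j := by
    rw [← Complex.exp_pi_mul_I, ← Complex.exp_int_mul, ← Complex.exp_add]
    push_cast
    ring_nf
  rw [sinc_pi_mul_sub_int h, e]
  push_cast
  ring

theorem abs_sinc_add_le_one {f : ℝ} (hf : |f| ≤ 1 / 2) :
    |Real.sinc (Real.pi * f)| + |Real.sin (Real.pi * f)| / Real.pi * (2 * (2 * |f| - 3 / 4)) ≤
      1 := by
  have hpi := Real.pi_pos
  by_cases h : |f| ≤ 3 / 8
  · have : |Real.sin (Real.pi * f)| / Real.pi * (2 * (2 * |f| - 3 / 4)) ≤ 0 :=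
      mul_nonpos_of_nonneg_of_nonpos (by positivity) (by linarith)
    linarith [Real.abs_sinc_le_one (Real.pi * f)]
  · push Not at h
    have hf0 : 0 < |f| := by linarith
    have h0 : f - (0 : ℤ) ≠ 0 := by simpa using abs_pos.1 hf0
    have e := abs_sinc_pi_mul_sub_int h0
    simp only [Int.cast_zero, sub_zero] at e
    have hq : 1 / |f| + 2 * (2 * |f| - 3 / 4) ≤ 3 := by
      have : 1 / |f| ≤ 9 / 2 - 4 * |f| := by
        rw [div_le_iff₀ hf0]
        nlinarith
      linarith
    rw [e, ← mul_add]
    calc |Real.sin (Real.pi * f)| / Real.pi * (1 / |f| + 2 * (2 * |f| - 3 / 4))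
        ≤ 1 / Real.pi * 3 := by
          gcongr
          · have : 0 ≤ 1 / |f| := by positivity
            have : 1 / |f| ≥ 2 := by
              rw [ge_iff_le, le_div_iff₀ hf0]; linarith
            linarith
          · exact Real.abs_sin_le_one _
      _ ≤ 1 := by
        rw [div_mul_eq_mul_div, div_le_one hpi]
        linarith [Real.pi_gt_three]

theorem norm_sum_sinc_centered_le {f : ℝ} (hf : |f| ≤ 1 / 2) (θ : ℝ) (M : ℕ) :
    ‖∑ j ∈ Finset.Icc (-(M : ℤ)) M,
      Complex.exp ((θ * j : ℝ) * Complex.I) * (Real.sinc (Real.pi * (f - j)) : ℂ)‖ ≤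
      1 + |Real.sin (Real.pi * f)| / Real.pi * (2 * (1 + SiPi)) := by
  obtain ⟨hf1, hf2⟩ := abs_le.1 hf
  have h := sum_Icc_sub_add_eq (fun j : ℤ =>
    Complex.exp ((θ * j : ℝ) * Complex.I) * (Real.sinc (Real.pi * (f - j)) : ℂ)) 0 M
  simp only [zero_sub, zero_add] at h
  rw [h, Finset.sum_congr rfl (g := fun j : ℕ => ((Real.sin (Real.pi * f) / Real.pi : ℝ) : ℂ) *
    (Complex.exp (((j + 1) * (θ + Real.pi) : ℝ) * Complex.I) / (f - (j + 1) : ℝ) +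
      Complex.exp ((-((j + 1) * (θ + Real.pi)) : ℝ) * Complex.I) / (f + (j + 1) : ℝ)))
    fun j _ => ?_, ← Finset.mul_sum]
  · refine (norm_add_le _ _).trans ?_
    rw [norm_mul, norm_mul, Complex.norm_exp_ofReal_mul_I, Complex.norm_real, Complex.norm_real,
      Real.norm_eq_abs, Real.norm_eq_abs, abs_div, abs_of_pos Real.pi_pos, Int.cast_zero, sub_zero,
      one_mul]
    have h1 := abs_sinc_add_le_one hf
    have h2 := mul_le_mul_of_nonneg_left (norm_sum_exp_div_le hf (θ + Real.pi) M)
      (by positivity : 0 ≤ |Real.sin (Real.pi * f)| / Real.pi)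
    linarith
  · have hj : (0 : ℝ) ≤ j := Nat.cast_nonneg j
    rw [exp_mul_sinc_eq θ f (by push_cast; linarith), exp_mul_sinc_eq θ f (by push_cast; linarith),
      ← mul_add]
    push_cast
    ring_nf

theorem norm_sum_exp_mul_sinc_le {x : ℝ} (hx : 0 < x) {n : ℕ} (hn : x < n) (θ : ℝ) :
    ‖∑ k ∈ Finset.Icc (-(n : ℤ)) n,
      Complex.exp ((θ * k : ℝ) * Complex.I) * (Real.sinc (Real.pi * (x - k)) : ℂ)‖ ≤
      1 + |Real.sin (Real.pi * x)| / Real.pi * (2 * (1 + SiPi + (x + 1 / 2) / (n - x))) := by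
  set G : ℤ → ℂ := fun k =>
    Complex.exp ((θ * k : ℝ) * Complex.I) * (Real.sinc (Real.pi * (x - k)) : ℂ) with hG
  obtain ⟨hr1, hr2⟩ := abs_le.1 (abs_sub_round x)
  have hk0 : 0 ≤ round x := by
    have : ((-1 : ℤ) : ℝ) < round x := by push_cast; linarith
    have := Int.cast_lt.1 this
    omega
  have hkn : round x ≤ n := by
    have : (round x : ℝ) < ((n + 1 : ℤ) : ℝ) := by push_cast; linarith
    have := Int.cast_lt.1 this
    omega
  obtain ⟨k, hk⟩ := Int.eq_ofNat_of_zero_le hk0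
  have hkn' : k ≤ n := by omega
  obtain ⟨M, hM⟩ := Nat.exists_eq_add_of_le hkn'
  have hf : |x - (k : ℤ)| ≤ 1 / 2 := by rw [← hk]; exact abs_sub_round x
  have hMn : (n : ℝ) = k + M := by rw [hM]; push_cast; ring
  have hsplit : ∑ i ∈ Finset.Icc (-(n : ℤ)) n, G i =
      ∑ i ∈ Finset.Ico (-(n : ℤ)) (k - M), G i + ∑ i ∈ Finset.Icc ((k : ℤ) - M) n, G i := by
    rw [← Finset.sum_union]
    · congr 1
      ext i
      simp only [Finset.mem_Icc, Finset.mem_union, Finset.mem_Ico]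
      omega
    · rw [Finset.disjoint_left]
      intro i
      simp only [Finset.mem_Icc, Finset.mem_Ico]
      omega
  have hcenter : ‖∑ i ∈ Finset.Icc ((k : ℤ) - M) n, G i‖ ≤
      1 + |Real.sin (Real.pi * x)| / Real.pi * (2 * (1 + SiPi)) := by
    have h := norm_sum_sinc_centered_le hf θ M
    rw [abs_sin_pi_mul_sub_int] at h
    refine le_of_eq_of_le ?_ h
    have hmap : Finset.Icc ((k : ℤ) - M) n =
        (Finset.Icc (-(M : ℤ)) M).map (addLeftEmbedding (k : ℤ)) := by
      rw [Finset.map_add_left_Icc, hM]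
      push_cast
      rfl
    have hshift : ∑ i ∈ Finset.Icc ((k : ℤ) - M) n, G i =
        Complex.exp ((θ * k : ℝ) * Complex.I) * ∑ j ∈ Finset.Icc (-(M : ℤ)) M,
          Complex.exp ((θ * j : ℝ) * Complex.I) *
            (Real.sinc (Real.pi * (x - (k : ℤ) - j)) : ℂ) := by
      rw [hmap, Finset.sum_map, Finset.mul_sum]
      refine Finset.sum_congr rfl fun j _ => ?_
      rw [← mul_assoc, ← Complex.exp_add]
      simp only [hG, addLeftEmbedding_apply]
      push_cast
      ring_nf
    rw [hshift, norm_mul, Complex.norm_exp_ofReal_mul_I, one_mul]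
  have hnx : 0 < n - x := by linarith
  have hleft : ‖∑ i ∈ Finset.Ico (-(n : ℤ)) (k - M), G i‖ ≤
      |Real.sin (Real.pi * x)| / Real.pi * (2 * ((x + 1 / 2) / (n - x))) := by
    have hterm : ∀ i ∈ Finset.Ico (-(n : ℤ)) (k - M),
        ‖G i‖ ≤ |Real.sin (Real.pi * x)| / Real.pi * (1 / (n - x)) := by
      intro i hi
      have hi2 : (i : ℝ) ≤ ((k - M - 1 : ℤ) : ℝ) := by
        have := (Finset.mem_Ico.1 hi).2
        exact Int.cast_le.2 (by omega)
      push_cast at hi2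
      rw [hk, Int.cast_natCast] at hr1
      have hxi : n - x ≤ x - i := by linarith
      rw [hG, norm_mul, Complex.norm_exp_ofReal_mul_I, one_mul, Complex.norm_real,
        Real.norm_eq_abs, abs_sinc_pi_mul_sub_int (by linarith),
        abs_of_pos (by linarith : 0 < x - i)]
      have := Real.pi_pos
      gcongr
    refine (norm_sum_le_of_le _ hterm).trans ?_
    rw [Finset.sum_const, Int.card_Ico, nsmul_eq_mul,
      show ((k : ℤ) - M - -(n : ℤ)).toNat = 2 * k by omega]
    have hk2 : ((2 * k : ℕ) : ℝ) ≤ 2 * (x + 1 / 2) := by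
      rw [hk, Int.cast_natCast] at hr1
      push_cast
      linarith
    calc ((2 * k : ℕ) : ℝ) * (|Real.sin (Real.pi * x)| / Real.pi * (1 / (n - x)))
        ≤ 2 * (x + 1 / 2) * (|Real.sin (Real.pi * x)| / Real.pi * (1 / (n - x))) := by
          have := Real.pi_pos
          gcongr
      _ = _ := by ring
  rw [hsplit]
  refine (norm_add_le _ _).trans ?_
  linarith

/-- deterministic bound on the truncated WKS approximation error of
the exponential `e^{iλt}`. -/
theorem exp_wks_truncation_bound (ω t l : ℝ) (hω : 0 < ω) (ht : 0 < t)
    (n : ℕ) (hn : ω * t / Real.pi < (n : ℝ)) :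
    ‖Complex.exp (Complex.I * (l : ℂ) * (t : ℂ)) -
        ∑ k ∈ Finset.Icc (-(n : ℤ)) (n : ℤ),
          Complex.exp (Complex.I * (l : ℂ) * (k : ℂ) * (Real.pi : ℂ) / (ω : ℂ)) *
            (msinc (ω * t - k * Real.pi) : ℂ)‖ ≤
      2 + (2 * |Real.sin (ω * t)| / Real.pi) *
        (1 + SiPi + (ω * t / Real.pi + 0.5) / ((n : ℝ) - ω * t / Real.pi)) := by

  have hpi := Real.pi_pos
  have hx : 0 < ω * t / Real.pi := by positivity
  have key := norm_sum_exp_mul_sinc_le hx hn (l * Real.pi / ω)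
  rw [mul_div_cancel₀ _ hpi.ne'] at key
  have hnorm : ‖Complex.exp (Complex.I * (l : ℂ) * (t : ℂ))‖ = 1 := by
    rw [← Complex.norm_exp_ofReal_mul_I (l * t)]
    push_cast
    ring_nf
  refine (norm_sub_le _ _).trans ?_
  rw [hnorm, Finset.sum_congr rfl (g := fun k : ℤ =>
    Complex.exp ((l * Real.pi / ω * k : ℝ) * Complex.I) *
      (Real.sinc (Real.pi * (ω * t / Real.pi - k)) : ℂ)) fun k _ => ?_]
  · calc _ ≤ 1 + (1 + |Real.sin (ω * t)| / Real.pi *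
          (2 * (1 + SiPi + (ω * t / Real.pi + 1 / 2) / (n - ω * t / Real.pi)))) := by gcongr
      _ = _ := by norm_num; ring
  · rw [msinc_eq_real_sinc, mul_sub, mul_div_cancel₀ _ hpi.ne', mul_comm Real.pi (k : ℝ)]
    push_cast
    ring_nf
end
end

section
/- Let ω > 0, t > 0 with ωt/π ∉ ℤ, let θ ∈ ℝ, and let n ∈ ℕ with n > ωt/π. Then |sin(ωt)|·|Σ_{k=−n}^{n} e^{ikθ}/(ωt − kπ)| ≤ 1 + (2|sin(ωt)|/π)·(1 + Si(π) + (ωt/π + 0.5)/(n − ωt/π)). -/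
open MeasureTheory

noncomputable section

/-- `sinc` is decreasing on `[0, π]`. -/
lemma antitoneOn_sinc : AntitoneOn Real.sinc (Set.Icc 0 Real.pi) := by
  intro u hu v hv huv
  rcases hu.1.eq_or_lt with h0 | h0
  · rw [← h0, Real.sinc_zero]
    exact Real.sinc_le_one v
  have hv0 : 0 < v := h0.trans_le huv
  rw [Real.sinc_of_ne_zero h0.ne', Real.sinc_of_ne_zero hv0.ne', div_le_div_iff₀ hv0 h0]
  have h := strictConcaveOn_sin_Icc.concaveOn.2 (Set.left_mem_Icc.2 Real.pi_pos.le) hv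
    (sub_nonneg.2 ((div_le_one hv0).2 huv)) (by positivity : 0 ≤ u / v) (by ring)
  simp only [smul_eq_mul, mul_zero, Real.sin_zero, zero_add] at h
  rw [div_mul_cancel₀ _ hv0.ne', div_mul_eq_mul_div, div_le_iff₀ hv0] at h
  linarith

lemma SiPi_eq_integral_sinc : SiPi = ∫ u in (0 : ℝ)..Real.pi, Real.sinc u := by
  unfold SiPi
  refine intervalIntegral.integral_congr_ae (Filter.Eventually.of_forall fun u hu => ?_)
  rw [Set.uIoc_of_le Real.pi_pos.le] at hu
  rw [Real.sinc_of_ne_zero hu.1.ne']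

lemma sinc_nonneg_of_mem_Icc {u : ℝ} (hu : u ∈ Set.Icc 0 Real.pi) : 0 ≤ Real.sinc u := by
  have := antitoneOn_sinc hu (Set.right_mem_Icc.2 Real.pi_pos.le) hu.2
  simpa [Real.sinc_of_ne_zero Real.pi_ne_zero] using this

lemma SiPi_nonneg : 0 ≤ SiPi := by
  rw [SiPi_eq_integral_sinc]
  exact intervalIntegral.integral_nonneg Real.pi_pos.le fun u hu => sinc_nonneg_of_mem_Icc hu

/-- A right Riemann sum for `∫₀^π sinc`. -/
lemma sum_sin_mul_div_le_SiPi {θ : ℝ} (hθ : 0 < θ) {K : ℕ} (hK : K * θ ≤ Real.pi) :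
    ∑ k ∈ Finset.Ico 1 (K + 1), Real.sin (k * θ) / k ≤ SiPi := by
  have hanti : AntitoneOn (fun u : ℝ => θ * Real.sinc (θ * u)) (Set.Icc 0 (0 + (K : ℝ))) := by
    have hmem : ∀ u ∈ Set.Icc (0 : ℝ) (0 + K), θ * u ∈ Set.Icc 0 Real.pi := fun u hu =>
      ⟨mul_nonneg hθ.le hu.1, by nlinarith [hu.2]⟩
    intro u hu v hv huv
    exact mul_le_mul_of_nonneg_left (antitoneOn_sinc (hmem u hu) (hmem v hv)
      (mul_le_mul_of_nonneg_left huv hθ.le)) hθ.le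
  have h := hanti.sum_le_integral
  have hint : ∫ u in (0 : ℝ)..0 + K, θ * Real.sinc (θ * u) =
      ∫ u in (0 : ℝ)..K * θ, Real.sinc u := by
    rw [intervalIntegral.integral_const_mul, intervalIntegral.integral_comp_mul_left _ hθ.ne']
    simp [mul_inv_cancel_left₀ hθ.ne', mul_comm]
  rw [hint] at h
  have hsum : ∑ k ∈ Finset.Ico 1 (K + 1), Real.sin (k * θ) / k =
      ∑ i ∈ Finset.range K, θ * Real.sinc (θ * (0 + ((i + 1 : ℕ) : ℝ))) := by
    rw [Finset.sum_Ico_eq_sum_range]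
    refine Finset.sum_congr (by simp) fun i _ => ?_
    have hi : (0 : ℝ) < ((i + 1 : ℕ) : ℝ) := by positivity
    rw [zero_add, Real.sinc_of_ne_zero (mul_pos hθ hi).ne', add_comm 1 i, mul_comm _ θ]
    field_simp
  rw [hsum, SiPi_eq_integral_sinc]
  refine h.trans (intervalIntegral.integral_mono_interval le_rfl (by positivity) hK ?_
    (Real.continuous_sinc.intervalIntegrable _ _))
  filter_upwards [ae_restrict_mem measurableSet_Ioc] with u hu
  exact sinc_nonneg_of_mem_Icc ⟨hu.1.le, hu.2⟩

/-- Summation by parts against `1 / k`. -/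
lemma abs_sum_sub_div_add_le (T : ℕ → ℝ) (hT : ∀ k, |T k| ≤ 1) {A B : ℕ} (hA : 1 ≤ A)
    (hAB : A ≤ B) :
    |∑ k ∈ Finset.Ico A B, (T k - T (k + 1)) / k + T B / B| ≤ 2 / A - 1 / B := by
  have hA0 : (0 : ℝ) < A := by exact_mod_cast hA
  induction B, hAB using Nat.le_induction with
  | base =>
    rw [Finset.Ico_self, Finset.sum_empty, zero_add, abs_div, Nat.abs_cast, ← sub_div]
    gcongr
    linarith [hT A]
  | succ B hB ih =>
    have hB0 : (0 : ℝ) < B := by exact_mod_cast hA.trans hB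
    rw [Finset.sum_Ico_succ_top hB]
    have hd : (0 : ℝ) ≤ 1 / (B : ℝ) - 1 / ((B + 1 : ℕ) : ℝ) := by
      rw [sub_nonneg]; gcongr; simp
    have key : ∑ k ∈ Finset.Ico A B, (T k - T (k + 1)) / k + (T B - T (B + 1)) / B
          + T (B + 1) / ((B + 1 : ℕ) : ℝ) =
        (∑ k ∈ Finset.Ico A B, (T k - T (k + 1)) / k + T B / B) -
          T (B + 1) * (1 / (B : ℝ) - 1 / ((B + 1 : ℕ) : ℝ)) := by ring
    rw [key]
    refine (abs_sub _ _).trans ?_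
    rw [abs_mul, abs_of_nonneg hd]
    nlinarith [hT (B + 1)]

lemma abs_sum_sin_div_le_one {θ : ℝ} (hθ : 0 < θ) (hθ' : θ ≤ Real.pi) {A B : ℕ}
    (hA : Real.pi ≤ A * θ) : |∑ k ∈ Finset.Ico A B, Real.sin (k * θ) / k| ≤ 1 := by
  rcases le_total B A with hBA | hAB
  · simp [Finset.Ico_eq_empty_of_le hBA]
  have hA0 : (0 : ℝ) < A := by
    by_contra! h
    nlinarith [Real.pi_pos]
  have hA1 : 1 ≤ A := by exact_mod_cast hA0
  have hB0 : (0 : ℝ) < B := hA0.trans_le (by exact_mod_cast hAB)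
  have hs : θ / Real.pi ≤ Real.sin (θ / 2) := by
    have := Real.mul_le_sin (x := θ / 2) (by positivity) (by linarith)
    calc θ / Real.pi = 2 / Real.pi * (θ / 2) := by ring
      _ ≤ _ := this
  have hs0 : 0 < Real.sin (θ / 2) := (div_pos hθ Real.pi_pos).trans_le hs
  set T : ℕ → ℝ := fun k => Real.cos ((k - 1 / 2) * θ) with hTdef
  have hT : ∀ k, |T k| ≤ 1 := fun k => Real.abs_cos_le_one _
  have hterm : ∀ k : ℕ, Real.sin (k * θ) / k =
      (T k - T (k + 1)) / k / (2 * Real.sin (θ / 2)) := by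
    intro k
    have : T k - T (k + 1) = Real.sin (k * θ) * (2 * Real.sin (θ / 2)) := by
      simp only [hTdef]
      push_cast
      rw [Real.cos_sub_cos]
      rw [show (((k : ℝ) - 1 / 2) * θ + ((k : ℝ) + 1 - 1 / 2) * θ) / 2 = k * θ by ring,
        show (((k : ℝ) - 1 / 2) * θ - ((k : ℝ) + 1 - 1 / 2) * θ) / 2 = -(θ / 2) by ring,
        Real.sin_neg]
      ring
    rw [this]
    field_simp
  have h1 := abs_sum_sub_div_add_le T hT hA1 hAB
  have h2 : |T B / B| ≤ 1 / B := by
    rw [abs_div, Nat.abs_cast]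
    gcongr
    exact hT B
  have h3 : |∑ k ∈ Finset.Ico A B, (T k - T (k + 1)) / k| ≤ 2 / A := by
    rw [abs_le] at *
    constructor <;> linarith [h1.1, h1.2, h2.1, h2.2]
  rw [Finset.sum_congr rfl fun k _ => hterm k, ← Finset.sum_div, abs_div,
    abs_of_pos (by positivity : 0 < 2 * Real.sin (θ / 2)), div_le_one (by positivity)]
  refine h3.trans ?_
  rw [div_le_iff₀ hA0]
  rw [div_le_iff₀ Real.pi_pos] at hs
  nlinarith [Real.pi_pos]

lemma abs_sum_sin_div_le_of_pos {θ : ℝ} (hθ : 0 < θ) (hθ' : θ ≤ Real.pi) {A B : ℕ}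
    (hA : 1 ≤ A) : |∑ k ∈ Finset.Ico A B, Real.sin (k * θ) / k| ≤ 1 + SiPi := by
  set K := ⌊Real.pi / θ⌋₊ with hKdef
  have hK : K * θ ≤ Real.pi := by
    rw [← le_div_iff₀ hθ]
    exact Nat.floor_le (by positivity)
  have hK' : Real.pi ≤ ((K + 1 : ℕ) : ℝ) * θ := by
    rw [← div_le_iff₀ hθ]
    push_cast
    exact (Nat.lt_floor_add_one _).le
  have hnonneg : ∀ k ∈ Finset.Ico 1 (K + 1), 0 ≤ Real.sin (k * θ) / k := by
    intro k hk
    rw [Finset.mem_Ico] at hk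
    have : (k : ℝ) ≤ K := by exact_mod_cast Nat.lt_succ_iff.1 hk.2
    exact div_nonneg (Real.sin_nonneg_of_nonneg_of_le_pi (by positivity) (by nlinarith))
      (by positivity)
  have hhead : ∀ C ≤ K + 1, |∑ k ∈ Finset.Ico A C, Real.sin (k * θ) / k| ≤ SiPi := by
    intro C hC
    have hsub : Finset.Ico A C ⊆ Finset.Ico 1 (K + 1) := Finset.Ico_subset_Ico hA hC
    rw [abs_of_nonneg (Finset.sum_nonneg fun k hk => hnonneg k (hsub hk))]
    exact (Finset.sum_le_sum_of_subset_of_nonneg hsub fun k hk _ => hnonneg k hk).trans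
      (sum_sin_mul_div_le_SiPi hθ hK)
  rcases le_total B (K + 1) with hB | hB
  · linarith [hhead B hB]
  rcases le_total (K + 1) A with hA' | hA'
  · have : |∑ k ∈ Finset.Ico A B, Real.sin (k * θ) / k| ≤ 1 :=
      abs_sum_sin_div_le_one hθ hθ' (hK'.trans (by gcongr))
    linarith [SiPi_nonneg]
  · rw [← Finset.sum_Ico_consecutive _ hA' hB]
    refine (abs_add_le _ _).trans ?_
    linarith [hhead (K + 1) le_rfl, abs_sum_sin_div_le_one (B := B) hθ hθ' hK']

/-- Blocks of the series `∑ sin (k θ) / k` are uniformly bounded by `1 + Si(π)`. -/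
lemma abs_sum_sin_div_le_s6 (θ : ℝ) {A B : ℕ} (hA : 1 ≤ A) :
    |∑ k ∈ Finset.Ico A B, Real.sin (k * θ) / k| ≤ 1 + SiPi := by
  set r : ℤ := round (θ / (2 * Real.pi)) with hr
  set ψ : ℝ := θ - r * (2 * Real.pi) with hψ
  have hsin : ∀ k : ℕ, Real.sin (k * θ) = Real.sin (k * ψ) := by
    intro k
    rw [show (k : ℝ) * ψ = k * θ - ((k * r : ℤ) : ℝ) * (2 * Real.pi) by
      rw [hψ]; push_cast; ring, Real.sin_sub_int_mul_two_pi]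
  have hψπ : |ψ| ≤ Real.pi := by
    have h := abs_sub_round (θ / (2 * Real.pi))
    have : ψ = (θ / (2 * Real.pi) - r) * (2 * Real.pi) := by
      rw [hψ]
      field_simp
    rw [this, abs_mul, abs_of_pos Real.two_pi_pos]
    nlinarith [Real.pi_pos]
  simp_rw [hsin]
  rcases lt_trichotomy ψ 0 with h | h | h
  · have := abs_sum_sin_div_le_of_pos (neg_pos.2 h) ((neg_le_abs ψ).trans hψπ) (B := B) hA
    simpa [neg_div] using this
  · simp [h]
    linarith [SiPi_nonneg]
  · exact abs_sum_sin_div_le_of_pos h ((le_abs_self ψ).trans hψπ) hA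

lemma sum_Icc_neg_succ {E : Type*} [AddCommMonoid E] (a : ℤ → E) (M : ℕ) :
    ∑ k ∈ Finset.Icc (-((M + 1 : ℕ) : ℤ)) ((M + 1 : ℕ) : ℤ), a k =
      ∑ k ∈ Finset.Icc (-(M : ℤ)) (M : ℤ), a k + (a (M + 1) + a (-(M + 1))) := by
  have h : Finset.Icc (-((M + 1 : ℕ) : ℤ)) ((M + 1 : ℕ) : ℤ) =
      insert ((M : ℤ) + 1) (insert (-((M : ℤ) + 1)) (Finset.Icc (-(M : ℤ)) (M : ℤ))) := by
    ext k
    simp only [Finset.mem_Icc, Finset.mem_insert]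
    push_cast
    omega
  rw [h, Finset.sum_insert, Finset.sum_insert, ← add_assoc, add_comm]
  · simp
  · simp only [Finset.mem_insert, Finset.mem_Icc]
    omega

lemma sum_Icc_neg_eq_sum_range {E : Type*} [AddCommMonoid E] (a : ℤ → E) (M : ℕ) :
    ∑ k ∈ Finset.Icc (-(M : ℤ)) (M : ℤ), a k =
      a 0 + ∑ i ∈ Finset.range M, (a (i + 1) + a (-(i + 1))) := by
  induction M with
  | zero => simp
  | succ M ih => rw [sum_Icc_neg_succ, ih, Finset.sum_range_succ, add_assoc]

/-- Summing a Toeplitz matrix amounts to summing the symmetric partial sums of its symbol. -/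
lemma sum_toeplitz_eq_sum_Icc {E : Type*} [AddCommMonoid E] (a : ℤ → E) (N : ℕ) :
    ∑ j ∈ Finset.range N, ∑ l ∈ Finset.range N, a ((j : ℤ) - l) =
      ∑ M ∈ Finset.range N, ∑ k ∈ Finset.Icc (-(M : ℤ)) (M : ℤ), a k := by
  induction N with
  | zero => simp
  | succ N ih =>
    rw [Finset.sum_range_succ (fun M : ℕ => ∑ k ∈ Finset.Icc (-(M : ℤ)) (M : ℤ), a k), ← ih,
      sum_Icc_neg_eq_sum_range, Finset.sum_range_succ]
    simp_rw [Finset.sum_range_succ _ N]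
    rw [Finset.sum_add_distrib, Finset.sum_add_distrib,
      ← Finset.sum_range_reflect (fun i : ℕ => a ((i : ℤ) + 1)),
      ← Finset.sum_range_reflect (fun i : ℕ => a (-((i : ℤ) + 1)))]
    have h1 : ∑ i ∈ Finset.range N, a (((N - 1 - i : ℕ) : ℤ) + 1) =
        ∑ l ∈ Finset.range N, a ((N : ℤ) - l) := by
      refine Finset.sum_congr rfl fun i hi => ?_
      rw [Finset.mem_range] at hi
      congr 1
      omega
    have h2 : ∑ i ∈ Finset.range N, a (-(((N - 1 - i : ℕ) : ℤ) + 1)) =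
        ∑ j ∈ Finset.range N, a ((j : ℤ) - N) := by
      refine Finset.sum_congr rfl fun i hi => ?_
      rw [Finset.mem_range] at hi
      congr 1
      omega
    rw [h1, h2, sub_self]
    abel

lemma integral_exp_mul_sub_int {x : ℝ} {k : ℤ} (hxk : x ≠ k) :
    ∫ φ in (0 : ℝ)..2 * Real.pi, Complex.exp (Complex.I * ((x - k : ℝ) : ℂ) * φ) =
      (Complex.exp (2 * Real.pi * Complex.I * x) - 1) /
        (Complex.I * ((x - k : ℝ) : ℂ)) := by
  have hc : Complex.I * ((x - k : ℝ) : ℂ) ≠ 0 :=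
    mul_ne_zero Complex.I_ne_zero (by exact_mod_cast sub_ne_zero.2 hxk)
  rw [integral_exp_mul_complex hc]
  congr 2
  · rw [show Complex.I * ((x - k : ℝ) : ℂ) * ((2 * Real.pi : ℝ) : ℂ) =
      2 * Real.pi * Complex.I * x - k * (2 * Real.pi * Complex.I) by push_cast; ring]
    rw [Complex.exp_sub, Complex.exp_int_mul_two_pi_mul_I, div_one]
  · simp

lemma norm_exp_two_pi_sub_one (x : ℝ) :
    ‖Complex.exp (2 * Real.pi * Complex.I * x) - 1‖ = 2 * |Real.sin (Real.pi * x)| := by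
  have h := Complex.norm_exp_I_mul_ofReal_sub_one (2 * Real.pi * x)
  rw [show (2 : ℂ) * Real.pi * Complex.I * x = Complex.I * ((2 * Real.pi * x : ℝ) : ℂ) by
    push_cast; ring, h, show 2 * Real.pi * x / 2 = Real.pi * x by ring]
  simp

/-- The Fejér-type square `|∑ e^{ijψ}|²` as a double sum. -/
lemma sum_sum_exp_eq_norm_sq (N : ℕ) (ψ : ℝ) :
    ∑ j ∈ Finset.range N, ∑ l ∈ Finset.range N,
        Complex.exp (Complex.I * (((j : ℤ) - l : ℤ) : ℂ) * ψ) =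
      ((‖∑ j ∈ Finset.range N, Complex.exp (Complex.I * j * ψ)‖ ^ 2 : ℝ) : ℂ) := by
  push_cast
  rw [← Complex.mul_conj', map_sum, Finset.sum_mul_sum]
  refine Finset.sum_congr rfl fun j _ => Finset.sum_congr rfl fun l _ => ?_
  rw [← Complex.exp_conj, ← Complex.exp_add]
  congr 1
  simp
  ring

lemma integral_norm_sq_sum_exp (N : ℕ) (θ : ℝ) :
    ∫ φ in (0 : ℝ)..2 * Real.pi,
      ‖∑ j ∈ Finset.range N, Complex.exp (Complex.I * j * ((θ - φ : ℝ) : ℂ))‖ ^ 2 =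
      2 * Real.pi * N := by
  apply Complex.ofReal_injective
  rw [← intervalIntegral.integral_ofReal]
  simp_rw [← sum_sum_exp_eq_norm_sq]
  rw [intervalIntegral.integral_finsetSum
    fun j _ => Continuous.intervalIntegrable (by fun_prop) _ _]
  have hterm : ∀ j l : ℕ, ∫ φ in (0 : ℝ)..2 * Real.pi,
      Complex.exp (Complex.I * (((j : ℤ) - l : ℤ) : ℂ) * ((θ - φ : ℝ) : ℂ)) =
      if j = l then (2 * Real.pi : ℂ) else 0 := by
    intro j l
    split_ifs with h
    · simp [h]
    · have h0 : (0 : ℝ) ≠ (((j : ℤ) - l : ℤ) : ℝ) := by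
        exact_mod_cast (sub_ne_zero.2 (by exact_mod_cast h : (j : ℤ) ≠ l)).symm
      have := integral_exp_mul_sub_int h0
      simp only [Complex.ofReal_zero, mul_zero, Complex.exp_zero, sub_self, zero_div] at this
      rw [← mul_zero (Complex.exp (Complex.I * (((j : ℤ) - l : ℤ) : ℂ) * θ)), ← this,
        ← intervalIntegral.integral_const_mul]
      congr 1
      ext φ
      rw [← Complex.exp_add]
      congr 1
      push_cast
      ring
  have hrow : ∀ j ∈ Finset.range N, ∫ φ in (0 : ℝ)..2 * Real.pi, ∑ l ∈ Finset.range N,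
      Complex.exp (Complex.I * (((j : ℤ) - l : ℤ) : ℂ) * ((θ - φ : ℝ) : ℂ)) =
      (2 * Real.pi : ℂ) := by
    intro j hj
    rw [intervalIntegral.integral_finsetSum
      fun l _ => Continuous.intervalIntegrable (by fun_prop) _ _]
    simp_rw [hterm]
    rw [Finset.sum_ite_eq, if_pos hj]
  rw [Finset.sum_congr rfl hrow]
  simp [mul_comm]

/-- The Toeplitz form with symbol `1 / (x - k)` is bounded by `π / |sin (π x)|`. -/
lemma norm_toeplitz_le {x : ℝ} (hx : ∀ m : ℤ, x ≠ m) (θ : ℝ) (N : ℕ) :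
    |Real.sin (Real.pi * x)| * ‖∑ j ∈ Finset.range N, ∑ l ∈ Finset.range N,
        Complex.exp (Complex.I * (((j : ℤ) - l : ℤ) : ℂ) * θ) /
          ((x - ((j : ℤ) - l : ℤ) : ℝ) : ℂ)‖ ≤ Real.pi * N := by
  set D := Complex.exp (2 * Real.pi * Complex.I * x) - 1 with hD
  have hint : ∫ φ in (0 : ℝ)..2 * Real.pi, Complex.exp (Complex.I * x * φ) *
      ((‖∑ j ∈ Finset.range N, Complex.exp (Complex.I * j * ((θ - φ : ℝ) : ℂ))‖ ^ 2 : ℝ) : ℂ) =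
      D / Complex.I * ∑ j ∈ Finset.range N, ∑ l ∈ Finset.range N,
        Complex.exp (Complex.I * (((j : ℤ) - l : ℤ) : ℂ) * θ) /
          ((x - ((j : ℤ) - l : ℤ) : ℝ) : ℂ) := by
    simp_rw [← sum_sum_exp_eq_norm_sq, Finset.mul_sum]
    rw [intervalIntegral.integral_finsetSum
      fun j _ => Continuous.intervalIntegrable (by fun_prop) _ _]
    refine Finset.sum_congr rfl fun j _ => ?_
    rw [intervalIntegral.integral_finsetSum
      fun l _ => Continuous.intervalIntegrable (by fun_prop) _ _]
    refine Finset.sum_congr rfl fun l _ => ?_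
    generalize (j : ℤ) - l = k
    have h := integral_exp_mul_sub_int (hx k)
    calc _ = ∫ φ in (0 : ℝ)..2 * Real.pi, Complex.exp (Complex.I * k * θ) *
          Complex.exp (Complex.I * ((x - k : ℝ) : ℂ) * φ) := by
          congr 1
          ext φ
          rw [← Complex.exp_add, ← Complex.exp_add]
          congr 1
          push_cast
          ring
      _ = _ := by
          rw [intervalIntegral.integral_const_mul, h, div_mul_div_comm, mul_comm D, mul_div_assoc]
  have hle : ‖∫ φ in (0 : ℝ)..2 * Real.pi, Complex.exp (Complex.I * x * φ) *
      ((‖∑ j ∈ Finset.range N, Complex.exp (Complex.I * j * ((θ - φ : ℝ) : ℂ))‖ ^ 2 : ℝ) : ℂ)‖ ≤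
      2 * Real.pi * N := by
    rw [← integral_norm_sq_sum_exp N θ]
    refine (intervalIntegral.norm_integral_le_integral_norm Real.two_pi_pos.le).trans_eq ?_
    congr 1
    ext φ
    rw [norm_mul, show Complex.I * x * φ = Complex.I * ((x * φ : ℝ) : ℂ) by push_cast; ring,
      Complex.norm_exp_I_mul_ofReal, one_mul, Complex.norm_real, Real.norm_of_nonneg (by positivity)]
  rw [hint, norm_mul, norm_div, Complex.norm_I, div_one, hD, norm_exp_two_pi_sub_one] at hle
  linarith

/-- Pairing `k` with `-k` leaves `sin (k θ) / k` and a telescoping remainder. -/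
lemma norm_pair_add_sin_le {x : ℝ} (hx : 0 < x) (θ : ℝ) {k : ℕ} (hk : x < k) :
    ‖Complex.exp (Complex.I * (((k : ℤ) + 1 : ℤ) : ℂ) * θ) / ((x - ((k : ℤ) + 1 : ℤ) : ℝ) : ℂ) +
        Complex.exp (Complex.I * ((-((k : ℤ) + 1) : ℤ) : ℂ) * θ) /
          ((x - (-((k : ℤ) + 1) : ℤ) : ℝ) : ℂ) +
        2 * Complex.I * ((Real.sin (((k + 1 : ℕ) : ℝ) * θ) / ((k + 1 : ℕ) : ℝ) : ℝ) : ℂ)‖ ≤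
      2 * x * (1 / (k - x) - 1 / (((k + 1 : ℕ) : ℝ) - x)) := by
  set K : ℝ := ((k + 1 : ℕ) : ℝ) with hK
  have hKk : (k : ℝ) = K - 1 := by simp [hK]
  rw [hKk] at hk ⊢
  have hK0 : 0 < K := by linarith
  have hp : 0 < K - x := by linarith
  have hq : 0 < K + x := by linarith
  have hexp : ∀ s : ℝ, ‖Complex.exp (Complex.I * (s : ℂ))‖ = 1 :=
    Complex.norm_exp_I_mul_ofReal
  have hsin : 2 * Complex.I * ((Real.sin (K * θ) : ℝ) : ℂ) =
      Complex.exp (Complex.I * ((K * θ : ℝ) : ℂ)) -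
        Complex.exp (Complex.I * ((-(K * θ) : ℝ) : ℂ)) := by
    rw [Complex.ofReal_sin, Complex.sin]
    push_cast
    rw [show -((K : ℂ) * θ) * Complex.I = Complex.I * -((K : ℂ) * θ) by ring,
      show (K : ℂ) * θ * Complex.I = Complex.I * ((K : ℂ) * θ) by ring]
    linear_combination (Complex.exp (Complex.I * -((K : ℂ) * θ)) -
      Complex.exp (Complex.I * ((K : ℂ) * θ))) * Complex.I_sq
  have e1 : Complex.I * (((k : ℤ) + 1 : ℤ) : ℂ) * θ = Complex.I * ((K * θ : ℝ) : ℂ) := by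
    rw [hK]; push_cast; ring
  have e2 : Complex.I * ((-((k : ℤ) + 1) : ℤ) : ℂ) * θ = Complex.I * ((-(K * θ) : ℝ) : ℂ) := by
    rw [hK]; push_cast; ring
  have e3 : x - (((k : ℤ) + 1 : ℤ) : ℝ) = x - K := by rw [hK]; push_cast; ring
  have e4 : x - ((-((k : ℤ) + 1) : ℤ) : ℝ) = x + K := by rw [hK]; push_cast; ring
  rw [e1, e2, e3, e4]
  have key : Complex.exp (Complex.I * ((K * θ : ℝ) : ℂ)) / ((x - K : ℝ) : ℂ) +
      Complex.exp (Complex.I * ((-(K * θ) : ℝ) : ℂ)) / ((x + K : ℝ) : ℂ) +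
      2 * Complex.I * ((Real.sin (K * θ) / K : ℝ) : ℂ) =
      -(Complex.exp (Complex.I * ((K * θ : ℝ) : ℂ)) * ((x / (K * (K - x)) : ℝ) : ℂ)) -
        Complex.exp (Complex.I * ((-(K * θ) : ℝ) : ℂ)) * ((x / (K * (K + x)) : ℝ) : ℂ) := by
    have c1 : (1 : ℂ) / ((x - K : ℝ) : ℂ) = ((-(1 / K) - x / (K * (K - x)) : ℝ) : ℂ) := by
      rw [show -(1 / K) - x / (K * (K - x)) = 1 / (x - K) by
        have : x - K ≠ 0 := by linarith
        field_simp
        ring]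
      push_cast; ring
    have c2 : (1 : ℂ) / ((x + K : ℝ) : ℂ) = ((1 / K - x / (K * (K + x)) : ℝ) : ℂ) := by
      rw [show 1 / K - x / (K * (K + x)) = 1 / (x + K) by
        field_simp
        ring]
      push_cast; ring
    rw [Complex.ofReal_div, mul_div_assoc', hsin, div_eq_mul_one_div _ ((x - K : ℝ) : ℂ),
      div_eq_mul_one_div _ ((x + K : ℝ) : ℂ), c1, c2]
    push_cast
    ring
  rw [key]
  refine (norm_sub_le _ _).trans ?_
  rw [norm_neg, norm_mul, norm_mul, hexp, hexp, one_mul, one_mul, Complex.norm_real,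
    Complex.norm_real, Real.norm_of_nonneg (by positivity), Real.norm_of_nonneg (by positivity)]
  have hr : 0 < K - 1 - x := by linarith
  have htel : 1 / (K - 1 - x) - 1 / (K - x) = 1 / ((K - 1 - x) * (K - x)) := by
    field_simp
    ring
  have b1 : x / (K * (K - x)) ≤ x / ((K - 1 - x) * (K - x)) := by
    gcongr
    linarith
  have b2 : x / (K * (K + x)) ≤ x / ((K - 1 - x) * (K - x)) := by
    gcongr <;> linarith
  rw [htel]
  calc _ ≤ x / ((K - 1 - x) * (K - x)) + x / ((K - 1 - x) * (K - x)) := add_le_add b1 b2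
    _ = _ := by ring

lemma norm_sum_Icc_sub_add_sin_le {x : ℝ} (hx : 0 < x) (θ : ℝ) {n M : ℕ} (hn : x < n)
    (hM : n ≤ M) :
    ‖∑ k ∈ Finset.Icc (-(M : ℤ)) (M : ℤ),
          Complex.exp (Complex.I * (k : ℂ) * θ) / ((x - k : ℝ) : ℂ) -
        ∑ k ∈ Finset.Icc (-(n : ℤ)) (n : ℤ),
          Complex.exp (Complex.I * (k : ℂ) * θ) / ((x - k : ℝ) : ℂ) +
        2 * Complex.I *
          ((∑ k ∈ Finset.Ico (n + 1) (M + 1), Real.sin (k * θ) / k : ℝ) : ℂ)‖ ≤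
      2 * x * (1 / (n - x) - 1 / (M - x)) := by
  induction M, hM using Nat.le_induction with
  | base => simp
  | succ M hM ih =>
    have hxM : x < M := hn.trans_le (by exact_mod_cast hM)
    have hstep := norm_pair_add_sin_le hx θ hxM
    rw [sum_Icc_neg_succ, Finset.sum_Ico_succ_top (by omega : n + 1 ≤ M + 1), Complex.ofReal_add]
    refine le_trans (le_of_eq ?_) ((norm_add_le _ _).trans (add_le_add ih hstep) |>.trans_eq ?_)
    · congr 1
      ring
    · ring

lemma norm_sum_Icc_sub_le {x : ℝ} (hx : 0 < x) (θ : ℝ) {n M : ℕ} (hn : x < n) (hM : n ≤ M) :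
    ‖∑ k ∈ Finset.Icc (-(n : ℤ)) (n : ℤ),
          Complex.exp (Complex.I * (k : ℂ) * θ) / ((x - k : ℝ) : ℂ) -
        ∑ k ∈ Finset.Icc (-(M : ℤ)) (M : ℤ),
          Complex.exp (Complex.I * (k : ℂ) * θ) / ((x - k : ℝ) : ℂ)‖ ≤
      2 * (1 + SiPi + x / (n - x)) := by
  have h1 := norm_sum_Icc_sub_add_sin_le hx θ hn hM
  have h2 := abs_sum_sin_div_le_s6 θ (A := n + 1) (B := M + 1) (by omega)
  set s := ∑ k ∈ Finset.Ico (n + 1) (M + 1), Real.sin (k * θ) / k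
  have hxM : x < M := hn.trans_le (by exact_mod_cast hM)
  have h3 : 0 ≤ 2 * x * (1 / (M - x)) := by
    have : 0 < M - x := sub_pos.2 hxM
    positivity
  have h4 : ‖2 * Complex.I * (s : ℂ)‖ = 2 * |s| := by simp
  rw [norm_sub_rev]
  have h5 := norm_sub_le_of_le h1 h4.le
  rw [add_sub_cancel_right] at h5
  refine h5.trans ?_
  have : x / (n - x) = x * (1 / (n - x)) := by ring
  rw [this]
  linarith

/-- A bound on Cesàro sums transfers to `S n` when later partial sums stay within `E` of it. -/
lemma norm_le_of_cesaro {F : Type*} [NormedAddCommGroup F] [NormedSpace ℝ F] (S : ℕ → F) {n : ℕ}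
    {C E : ℝ} (hC : ∀ N : ℕ, ‖∑ M ∈ Finset.range N, S M‖ ≤ C * N)
    (hE : ∀ M, n ≤ M → ‖S n - S M‖ ≤ E) : ‖S n‖ ≤ C + E := by
  by_contra! hlt
  set R := ∑ M ∈ Finset.range n, ‖S n - S M‖
  have hE0 : 0 ≤ E := (norm_nonneg _).trans (hE n le_rfl)
  obtain ⟨m, hm⟩ := exists_nat_gt (R / (‖S n‖ - (C + E)))
  rw [div_lt_iff₀ (sub_pos.2 hlt)] at hm
  set N := n + m
  have h1 : ∑ M ∈ Finset.range N, ‖S n - S M‖ ≤ R + m * E := by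
    rw [Finset.sum_range_add]
    gcongr
    refine (Finset.sum_le_card_nsmul _ _ E fun i _ => hE _ (Nat.le_add_right _ _)).trans_eq ?_
    simp
  have h2 : N * ‖S n‖ ≤ C * N + ∑ M ∈ Finset.range N, ‖S n - S M‖ := by
    have : (N : ℝ) • S n =
        ∑ M ∈ Finset.range N, S M + ∑ M ∈ Finset.range N, (S n - S M) := by
      rw [← Finset.sum_add_distrib]
      simp [Nat.cast_smul_eq_nsmul]
    calc N * ‖S n‖ = ‖(N : ℝ) • S n‖ := by simp [norm_smul]
      _ ≤ _ := by
        rw [this]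
        exact (norm_add_le _ _).trans (add_le_add (hC N) (norm_sum_le _ _))
  have hN : (N : ℝ) = n + m := by simp [N]
  rw [hN] at h2
  have hn0 : (0 : ℝ) ≤ n := n.cast_nonneg
  nlinarith [mul_nonneg hn0 (by linarith : 0 ≤ ‖S n‖ - C)]

lemma sin_pi_mul_ne_zero_of_ne_int {x : ℝ} (hx : ∀ m : ℤ, x ≠ m) : Real.sin (Real.pi * x) ≠ 0 := by
  intro h
  obtain ⟨m, hm⟩ := Real.sin_eq_zero_iff.1 h
  refine hx m (mul_left_cancel₀ Real.pi_ne_zero ?_)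
  rw [← hm, mul_comm]

/-- bound on `|sin(ωt)|·|Σ_{k=-n}^n e^{ikθ}/(ωt − kπ)|`. -/
theorem sin_weighted_exponential_sum_bound (ω t θ : ℝ) (hω : 0 < ω) (ht : 0 < t)
    (hnotint : ∀ m : ℤ, ω * t / Real.pi ≠ (m : ℝ))
    (n : ℕ) (hn : ω * t / Real.pi < (n : ℝ)) :
    |Real.sin (ω * t)| *
        ‖∑ k ∈ Finset.Icc (-(n : ℤ)) (n : ℤ),
          Complex.exp (Complex.I * (k : ℂ) * (θ : ℂ)) / ((ω * t - k * Real.pi : ℝ) : ℂ)‖ ≤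
      1 + (2 * |Real.sin (ω * t)| / Real.pi) *
        (1 + SiPi + (ω * t / Real.pi + 0.5) / ((n : ℝ) - ω * t / Real.pi)) := by
  set x := ω * t / Real.pi with hxdef
  have hπ := Real.pi_pos
  have hx : 0 < x := by positivity
  have hωt : ω * t = Real.pi * x := by rw [hxdef]; field_simp
  set S : ℕ → ℂ := fun M => ∑ k ∈ Finset.Icc (-(M : ℤ)) (M : ℤ),
    Complex.exp (Complex.I * (k : ℂ) * θ) / ((x - k : ℝ) : ℂ) with hS
  have hs : 0 < |Real.sin (Real.pi * x)| := abs_pos.2 (sin_pi_mul_ne_zero_of_ne_int hnotint)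
  have hC : ∀ N : ℕ, ‖∑ M ∈ Finset.range N, S M‖ ≤ Real.pi / |Real.sin (Real.pi * x)| * N := by
    intro N
    have h := norm_toeplitz_le hnotint θ N
    rw [sum_toeplitz_eq_sum_Icc
      (fun k : ℤ => Complex.exp (Complex.I * (k : ℂ) * θ) / ((x - k : ℝ) : ℂ))] at h
    rw [div_mul_eq_mul_div, le_div_iff₀ hs, mul_comm]
    exact h
  have hmain := norm_le_of_cesaro S hC fun M hM => norm_sum_Icc_sub_le hx θ hn hM
  have hsum : ∑ k ∈ Finset.Icc (-(n : ℤ)) (n : ℤ),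
      Complex.exp (Complex.I * (k : ℂ) * (θ : ℂ)) / ((ω * t - k * Real.pi : ℝ) : ℂ) =
      S n / Real.pi := by
    rw [hS, Finset.sum_div]
    refine Finset.sum_congr rfl fun k _ => ?_
    rw [div_div, hωt]
    congr 1
    push_cast
    ring
  rw [hsum, hωt, norm_div, Complex.norm_real, Real.norm_of_nonneg hπ.le]
  have hnx : 0 < n - x := sub_pos.2 hn
  have hle : x / (n - x) ≤ (x + 0.5) / (n - x) := by
    gcongr
    norm_num
  calc |Real.sin (Real.pi * x)| * (‖S n‖ / Real.pi)
      ≤ |Real.sin (Real.pi * x)| * ((Real.pi / |Real.sin (Real.pi * x)| +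
          2 * (1 + SiPi + (x + 0.5) / (n - x))) / Real.pi) := by
        gcongr
        linarith
    _ = _ := by field_simp
end
end
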